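/- Let S be a nonempty compact subset of ℝ^d, let c_1, …, c_N ∈ ℝ^d with N ≥ 1, and let c̄ = (1/N) ∑_{i=1}^N c_i be their average. If W*(c̄) = {w̄} is a singleton, then inf_{ĉ ∈ ℝ^d} ∑_{i=1}^N ℓ_SPO(ĉ, c_i) = ( min_{w ∈ S} ∑_{i=1}^N ⟪c_i, w⟫ ) − ∑_{i=1}^N z*(c_i); that is, the leafwise SPO-optimal prediction problem reduces to a single deterministic optimization over decisions w ∈ S. -/

import Mathlib

open scoped RealInnerProductSpace

/-- `zStar S c = min_{w ∈ S} ⟪c, w⟫`, the optimal value of the decision problem. -/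
noncomputable def zStar {d : ℕ} (S : Set (EuclideanSpace ℝ (Fin d)))
    (c : EuclideanSpace ℝ (Fin d)) : ℝ :=
  sInf ((fun w => ⟪c, w⟫) '' S)

/-- `WStar S c` is the set of optimal decisions for cost vector `c`. -/
def WStar {d : ℕ} (S : Set (EuclideanSpace ℝ (Fin d)))
    (c : EuclideanSpace ℝ (Fin d)) : Set (EuclideanSpace ℝ (Fin d)) :=
  {w ∈ S | ⟪c, w⟫ = zStar S c}

/-- The SPO loss `ℓ_SPO(ĉ, c) = max_{w ∈ W*(ĉ)} ⟪c, w⟫ − z*(c)`. -/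
noncomputable def spoLoss {d : ℕ} (S : Set (EuclideanSpace ℝ (Fin d)))
    (chat c : EuclideanSpace ℝ (Fin d)) : ℝ :=
  sSup ((fun w => ⟪c, w⟫) '' WStar S chat) - zStar S c

theorem zStar_isLeast {d : ℕ} {S : Set (EuclideanSpace ℝ (Fin d))} (hS : IsCompact S)
    (hSne : S.Nonempty) (c : EuclideanSpace ℝ (Fin d)) :
    IsLeast ((fun w => ⟪c, w⟫) '' S) (zStar S c) :=
  (hS.image (by fun_prop)).isLeast_sInf (hSne.image _)

theorem WStar_nonempty {d : ℕ} {S : Set (EuclideanSpace ℝ (Fin d))} (hS : IsCompact S)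
    (hSne : S.Nonempty) (c : EuclideanSpace ℝ (Fin d)) : (WStar S c).Nonempty :=
  (zStar_isLeast hS hSne c).1

/-- Any optimal decision for the prediction `chat` gives a lower bound on the SPO loss. -/
theorem inner_sub_zStar_le_spoLoss {d : ℕ} {S : Set (EuclideanSpace ℝ (Fin d))} (hS : IsCompact S)
    {chat w : EuclideanSpace ℝ (Fin d)} (c : EuclideanSpace ℝ (Fin d)) (hw : w ∈ WStar S chat) :
    ⟪c, w⟫ - zStar S c ≤ spoLoss S chat c := by
  refine sub_le_sub_right (le_csSup ?_ (Set.mem_image_of_mem _ hw)) _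
  exact (hS.image (by fun_prop)).bddAbove.mono (Set.image_mono (Set.sep_subset _ _))

theorem spoLoss_of_WStar_eq_singleton {d : ℕ} {S : Set (EuclideanSpace ℝ (Fin d))}
    {chat w : EuclideanSpace ℝ (Fin d)} (c : EuclideanSpace ℝ (Fin d)) (h : WStar S chat = {w}) :
    spoLoss S chat c = ⟪c, w⟫ - zStar S c := by
  simp [spoLoss, h]

/-- The leafwise SPO-optimal prediction problem reduces to a single deterministic
optimization over decisions `w ∈ S`. -/
theorem min_total_spo_loss_eq_min_total_cost {d N : ℕ} (S : Set (EuclideanSpace ℝ (Fin d)))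
    (hS : IsCompact S) (hSne : S.Nonempty) (hN : 1 ≤ N)
    (c : Fin N → EuclideanSpace ℝ (Fin d))
    (cbar : EuclideanSpace ℝ (Fin d)) (hcbar : cbar = (N : ℝ)⁻¹ • ∑ i, c i)
    (wbar : EuclideanSpace ℝ (Fin d)) (hsing : WStar S cbar = {wbar}) :
    sInf (Set.range fun chat => ∑ i, spoLoss S chat (c i))
      = sInf ((fun w => ∑ i, ⟪c i, w⟫) '' S) - ∑ i, zStar S (c i) := by
  have hN0 : (N : ℝ) ≠ 0 := by positivity
  have hsum : ∑ i, c i = (N : ℝ) • cbar := by rw [hcbar, smul_inv_smul₀ hN0]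
  have hinner (w : EuclideanSpace ℝ (Fin d)) : ∑ i, ⟪c i, w⟫ = N * ⟪cbar, w⟫ := by
    rw [← sum_inner, hsum, real_inner_smul_left]
  have hw : wbar ∈ WStar S cbar := by simp [hsing]
  have hle : ∀ w ∈ S, ∑ i, ⟪c i, wbar⟫ ≤ ∑ i, ⟪c i, w⟫ := fun w hwS => by
    rw [hinner, hinner, hw.2]
    exact mul_le_mul_of_nonneg_left
      ((zStar_isLeast hS hSne cbar).2 (Set.mem_image_of_mem _ hwS)) N.cast_nonneg
  have hcost : IsLeast ((fun w => ∑ i, ⟪c i, w⟫) '' S) (∑ i, ⟪c i, wbar⟫) :=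
    ⟨Set.mem_image_of_mem _ hw.1, Set.forall_mem_image.2 hle⟩
  rw [hcost.csInf_eq, ← Finset.sum_sub_distrib]
  refine IsLeast.csInf_eq ⟨⟨cbar, ?_⟩, Set.forall_mem_range.2 fun chat => ?_⟩
  · exact Finset.sum_congr rfl fun i _ => spoLoss_of_WStar_eq_singleton (c i) hsing
  · obtain ⟨w, hwc⟩ := WStar_nonempty hS hSne chat
    calc ∑ i, (⟪c i, wbar⟫ - zStar S (c i))
        ≤ ∑ i, (⟪c i, w⟫ - zStar S (c i)) := by
          simpa only [Finset.sum_sub_distrib] using sub_le_sub_right (hle w hwc.1) _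
      _ ≤ ∑ i, spoLoss S chat (c i) :=
          Finset.sum_le_sum fun i _ => inner_sub_zStar_le_spoLoss hS (c i) hwc
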